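/- arXiv:1911.03334 — 2 statements merged into one kernel-verified Lean document; each statement's English description precedes it below -/
import Mathlib

section
/- Let p be a prime, F a field of characteristic p, and α₁, α₂, α₃, β ∈ F with β ≠ 0, α₁ ≠ 0, α₂ ≠ 0 and (α₁·α₂⁻¹)^(p−1) ≠ 1. Then there exists a finite field extension K of F with [K:F] ≤ 2p−1 and p ∤ [K:F], together with elements u, v₁, v₂, v₃ ∈ K, such that (writing a' for the image in K of a ∈ F under the algebra map) the three elements α₁'^p + β'·(u^p − u·v₁^(p−1) + α₁'^p·v₁^p), α₂'^p + β'·(u^p − u·v₂^(p−1) + α₂'^p·v₂^p) and α₃'^p + β'·(u^p − u·v₃^(p−1) + α₃'^p·v₃^p) are all equal. (This is the equational content of the theorem that three inseparably linked symbol p-algebras [α₁,β), [α₂,β), [α₃,β) of degree p become cyclically linked under a prime-to-p extension of degree at most 2p−1: the common value is an Artin–Schreier generator of a common cyclic splitting field.) -/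
universe u v

/-- A bundled field extension of `F`: a field `carrier` together with an `F`-algebra structure. -/
structure FieldExtension (F : Type u) [Field F] : Type (u + 1) where
  /-- the underlying field of the extension -/
  carrier : Type u
  [fieldCarrier : Field carrier]
  [algebraCarrier : Algebra F carrier]

attribute [instance] FieldExtension.fieldCarrier FieldExtension.algebraCarrier

open Polynomial in
/-- A polynomial over a field whose degree is not divisible by `m` has an irreducible factor whose
degree is not divisible by `m`. -/
theorem exists_irreducible_dvd_not_dvd_natDegree {F : Type*} [Field F] (m : ℕ) (f : F[X])
    (hf : ¬ m ∣ f.natDegree) : ∃ q : F[X], Irreducible q ∧ q ∣ f ∧ ¬ m ∣ q.natDegree := by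
  induction f using WfDvdMonoid.induction_on_irreducible with
  | zero => simp at hf
  | unit g hg => simp [natDegree_eq_zero_of_isUnit hg] at hf
  | mul g q hg hq ih =>
    by_cases h : m ∣ q.natDegree
    · rw [natDegree_mul hq.ne_zero hg, Nat.dvd_add_right h] at hf
      obtain ⟨r, hr, hrg, hrm⟩ := ih hf
      exact ⟨r, hr, hrg.mul_left q, hrm⟩
    · exact ⟨q, hq, dvd_mul_right q g, h⟩

open Polynomial in
/-- A polynomial over `F` whose degree is not divisible by `m` has a root in an extension of `F`
whose degree is at most that of the polynomial and not divisible by `m`. -/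
theorem exists_fieldExtension_aeval_eq_zero {F : Type u} [Field F] (m : ℕ) (f : F[X])
    (hf : ¬ m ∣ f.natDegree) :
    ∃ K : FieldExtension F, FiniteDimensional F K.carrier ∧
      Module.finrank F K.carrier ≤ f.natDegree ∧ ¬ m ∣ Module.finrank F K.carrier ∧
      ∃ t : K.carrier, aeval t f = 0 := by
  obtain ⟨q, hq, hqf, hqm⟩ := exists_irreducible_dvd_not_dvd_natDegree m f hf
  have : Fact (Irreducible q) := ⟨hq⟩
  have hfin : Module.finrank F (AdjoinRoot q) = q.natDegree :=
    (AdjoinRoot.powerBasis hq.ne_zero).finrank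
  have hf₀ : f ≠ 0 := by
    rintro rfl
    simp at hf
  refine ⟨⟨AdjoinRoot q⟩, (AdjoinRoot.powerBasis hq.ne_zero).finite,
    hfin.trans_le (natDegree_le_of_dvd hqf hf₀), by rwa [hfin], AdjoinRoot.root q, ?_⟩
  rw [AdjoinRoot.aeval_eq, AdjoinRoot.mk_eq_zero]
  exact hqf

open Polynomial in
/-- A trinomial `b X ^ (2 * n + 1) + e X ^ n + d` with `b, d ≠ 0` has a nonzero root in an extension
of degree at most `2 * n + 1` and not divisible by `n + 1`. -/
theorem exists_fieldExtension_trinomial_root {F : Type u} [Field F] {n : ℕ} (hn : 1 ≤ n)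
    {b d : F} (e : F) (hb : b ≠ 0) (hd : d ≠ 0) :
    ∃ K : FieldExtension F, FiniteDimensional F K.carrier ∧
      Module.finrank F K.carrier ≤ 2 * n + 1 ∧ ¬ (n + 1) ∣ Module.finrank F K.carrier ∧
      ∃ t : K.carrier, t ≠ 0 ∧ algebraMap F K.carrier b * t ^ (2 * n + 1) +
        algebraMap F K.carrier e * t ^ n + algebraMap F K.carrier d = 0 := by
  set f : F[X] := C b * X ^ (2 * n + 1) + C e * X ^ n + C d with hf
  have hdeg : f.natDegree = 2 * n + 1 := by
    rw [hf, natDegree_add_C, natDegree_add_eq_left_of_natDegree_lt,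
      natDegree_C_mul_X_pow _ _ hb]
    rw [natDegree_C_mul_X_pow _ _ hb]
    exact (natDegree_C_mul_X_pow_le _ _).trans_lt (by omega)
  have hndvd : ¬ (n + 1) ∣ f.natDegree := by
    rw [hdeg, show 2 * n + 1 = (n + 1) + n by ring, Nat.dvd_add_right dvd_rfl]
    exact Nat.not_dvd_of_pos_of_lt hn n.lt_succ_self
  obtain ⟨K, hK, hle, hdvd, t, ht⟩ := exists_fieldExtension_aeval_eq_zero (n + 1) f hndvd
  have hroot : algebraMap F K.carrier b * t ^ (2 * n + 1) +
      algebraMap F K.carrier e * t ^ n + algebraMap F K.carrier d = 0 := by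
    simpa only [hf, map_add, map_mul, map_pow, aeval_C, aeval_X] using ht
  refine ⟨K, hK, hdeg ▸ hle, hdvd, t, ?_, hroot⟩
  rintro rfl
  rw [zero_pow (by omega), zero_pow (by omega), mul_zero, mul_zero, zero_add, zero_add] at hroot
  exact hd ((map_eq_zero _).mp hroot)

/-- Two Artin–Schreier-type norm equations can be solved explicitly from a nonzero root `t` of a
polynomial of degree `2 * n + 1`. -/
theorem exists_common_value_of_root {K : Type*} [Field K] (n : ℕ) {a₁ a₂ a₃ b c t : K}
    (ha₁ : a₁ ≠ 0) (ha₂ : a₂ ≠ 0) (ht : t ≠ 0)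
    (hc : b * c * (a₁⁻¹ ^ n - a₂⁻¹ ^ n) = a₁ ^ (n + 1) - a₂ ^ (n + 1))
    (hroot : b * t ^ (2 * n + 1) +
      (a₁ ^ (n + 1) - a₃ ^ (n + 1) - b * c * a₁⁻¹ ^ n - b * a₃ ^ (n + 1)) * t ^ n + b * c = 0) :
    ∃ u v₁ v₂ v₃ : K,
      a₁ ^ (n + 1) + b * (u ^ (n + 1) - u * v₁ ^ n + a₁ ^ (n + 1) * v₁ ^ (n + 1)) =
        a₂ ^ (n + 1) + b * (u ^ (n + 1) - u * v₂ ^ n + a₂ ^ (n + 1) * v₂ ^ (n + 1)) ∧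
      a₁ ^ (n + 1) + b * (u ^ (n + 1) - u * v₁ ^ n + a₁ ^ (n + 1) * v₁ ^ (n + 1)) =
        a₃ ^ (n + 1) + b * (u ^ (n + 1) - u * v₃ ^ n + a₃ ^ (n + 1) * v₃ ^ (n + 1)) := by
  have hs : t⁻¹ ^ n * t ^ n = 1 := by rw [← mul_pow, inv_mul_cancel₀ ht, one_pow]
  have hu (x : K) : c * t⁻¹ ^ n * (t * x) ^ n = c * x ^ n := by
    rw [mul_pow]; linear_combination c * x ^ n * hs
  have hv {a : K} (ha : a ≠ 0) : a ^ (n + 1) * (t * a⁻¹) ^ (n + 1) = t ^ (n + 1) := by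
    rw [← mul_pow, mul_comm t, mul_inv_cancel_left₀ ha]
  refine ⟨c * t⁻¹ ^ n, t * a₁⁻¹, t * a₂⁻¹, 1, ?_, ?_⟩
  · rw [hu, hu, hv ha₁, hv ha₂]
    linear_combination -hc
  · rw [hu, hv ha₁, one_pow, one_pow]
    have ht' : t ^ (2 * n + 1) = t ^ (n + 1) * t ^ n := by ring
    rw [ht'] at hroot
    linear_combination t⁻¹ ^ n * hroot - (b * t ^ (n + 1) +
      (a₁ ^ (n + 1) - a₃ ^ (n + 1) - b * c * a₁⁻¹ ^ n - b * a₃ ^ (n + 1))) * hs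

/-- Three inseparably linked symbol `p`-algebras `[α₁,β)`, `[α₂,β)`, `[α₃,β)` become cyclically
linked under a prime-to-`p` extension of degree at most `2p - 1`: equational form. -/
theorem inseparable_implies_cyclic_triple (p : ℕ) (hp : p.Prime) (F : Type u) [Field F]
    [CharP F p] (α₁ α₂ α₃ β : F) (hβ : β ≠ 0) (hα₁ : α₁ ≠ 0) (hα₂ : α₂ ≠ 0)
    (hne : (α₁ * α₂⁻¹) ^ (p - 1) ≠ 1) :
    ∃ K : FieldExtension F, FiniteDimensional F K.carrier ∧
      Module.finrank F K.carrier ≤ 2 * p - 1 ∧ ¬ (p ∣ Module.finrank F K.carrier) ∧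
      ∃ u v₁ v₂ v₃ : K.carrier,
        (algebraMap F K.carrier α₁) ^ p + (algebraMap F K.carrier β) *
            (u ^ p - u * v₁ ^ (p - 1) + (algebraMap F K.carrier α₁) ^ p * v₁ ^ p) =
          (algebraMap F K.carrier α₂) ^ p + (algebraMap F K.carrier β) *
            (u ^ p - u * v₂ ^ (p - 1) + (algebraMap F K.carrier α₂) ^ p * v₂ ^ p) ∧
        (algebraMap F K.carrier α₁) ^ p + (algebraMap F K.carrier β) *
            (u ^ p - u * v₁ ^ (p - 1) + (algebraMap F K.carrier α₁) ^ p * v₁ ^ p) =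
          (algebraMap F K.carrier α₃) ^ p + (algebraMap F K.carrier β) *
            (u ^ p - u * v₃ ^ (p - 1) + (algebraMap F K.carrier α₃) ^ p * v₃ ^ p) := by
  have : Fact p.Prime := ⟨hp⟩
  obtain ⟨n, rfl⟩ : ∃ n, p = n + 1 := ⟨p - 1, by have := hp.pos; omega⟩
  have hn : 1 ≤ n := by have := hp.two_le; omega
  simp only [Nat.add_sub_cancel] at hne ⊢
  have hd : α₁⁻¹ ^ n - α₂⁻¹ ^ n ≠ 0 := by
    intro h
    apply hne
    rw [mul_pow, ← sub_eq_zero.mp h, ← mul_pow, mul_inv_cancel₀ hα₁, one_pow]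
  have hsub : α₁ ^ (n + 1) - α₂ ^ (n + 1) ≠ 0 := by
    rw [← sub_pow_char (p := n + 1)]
    refine pow_ne_zero _ (sub_ne_zero.mpr ?_)
    rintro rfl
    exact hd (sub_self _)
  obtain ⟨c, hc⟩ : ∃ c, β * c * (α₁⁻¹ ^ n - α₂⁻¹ ^ n) = α₁ ^ (n + 1) - α₂ ^ (n + 1) :=
    ⟨(α₁ ^ (n + 1) - α₂ ^ (n + 1)) / (β * (α₁⁻¹ ^ n - α₂⁻¹ ^ n)), by
      rw [mul_right_comm, mul_div_cancel₀ _ (mul_ne_zero hβ hd)]⟩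
  have hc₀ : β * c ≠ 0 := left_ne_zero_of_mul (hc ▸ hsub)
  obtain ⟨K, hK, hle, hdvd, t, ht, hroot⟩ := exists_fieldExtension_trinomial_root hn
    (α₁ ^ (n + 1) - α₃ ^ (n + 1) - β * c * α₁⁻¹ ^ n - β * α₃ ^ (n + 1)) hβ hc₀
  let φ := algebraMap F K.carrier
  refine ⟨K, hK, by omega, hdvd, ?_⟩
  refine exists_common_value_of_root n (c := φ c) ((map_ne_zero φ).mpr hα₁)
    ((map_ne_zero φ).mpr hα₂) ht ?_ ?_
  · simpa only [map_sub, map_mul, map_pow, map_inv₀] using congrArg φ hc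
  · simpa only [map_sub, map_mul, map_pow, map_inv₀] using hroot
end

section
/- Let p be a prime, F a field of characteristic p, and α₁, α₂, α₃, β ∈ F with β ≠ 0, α₂ ≠ 0, and C := (α₁·α₂⁻¹)^(p−1) − 1 ≠ 0. Set A := α₃^p − α₁^p + (α₂^p − α₁^p)·C⁻¹. Suppose v₁ ∈ F satisfies the polynomial equation (A + β·(α₃^p − α₁^p·v₁^p))·C·v₁^(p−1) = α₂^p − α₁^p. Define u := β⁻¹·(A + β·(α₃^p − α₁^p·v₁^p)), v₂ := (α₁·α₂⁻¹)·v₁ and v₃ := 1. Then α₁^p + β·(u^p − u·v₁^(p−1) + α₁^p·v₁^p) = α₂^p + β·(u^p − u·v₂^(p−1) + α₂^p·v₂^p) and α₁^p + β·(u^p − u·v₁^(p−1) + α₁^p·v₁^p) = α₃^p + β·(u^p − u·v₃^(p−1) + α₃^p·v₃^p). -/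
universe u v


/-- The explicit verification at the heart of the triple cyclic linkage theorem: from a root
`v₁` of the degree `2p - 1` equation one builds `u`, `v₂`, `v₃` making the three Artin-Schreier
expressions equal. -/
theorem cyclic_linkage_identity (p : ℕ) (hp : p.Prime) (F : Type*) [Field F] [CharP F p]
    (α₁ α₂ α₃ β : F) (hβ : β ≠ 0) (hα₂ : α₂ ≠ 0)
    (C : F) (hC : C = (α₁ * α₂⁻¹) ^ (p - 1) - 1) (hC0 : C ≠ 0)
    (A : F) (hA : A = α₃ ^ p - α₁ ^ p + (α₂ ^ p - α₁ ^ p) * C⁻¹)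
    (v₁ : F) (hv₁ : (A + β * (α₃ ^ p - α₁ ^ p * v₁ ^ p)) * C * v₁ ^ (p - 1) = α₂ ^ p - α₁ ^ p)
    (u v₂ v₃ : F) (hu : u = β⁻¹ * (A + β * (α₃ ^ p - α₁ ^ p * v₁ ^ p)))
    (hv₂ : v₂ = (α₁ * α₂⁻¹) * v₁) (hv₃ : v₃ = 1) :
    α₁ ^ p + β * (u ^ p - u * v₁ ^ (p - 1) + α₁ ^ p * v₁ ^ p) =
      α₂ ^ p + β * (u ^ p - u * v₂ ^ (p - 1) + α₂ ^ p * v₂ ^ p) ∧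
    α₁ ^ p + β * (u ^ p - u * v₁ ^ (p - 1) + α₁ ^ p * v₁ ^ p) =
      α₃ ^ p + β * (u ^ p - u * v₃ ^ (p - 1) + α₃ ^ p * v₃ ^ p) := by
  have hβu : β * u = A + β * (α₃ ^ p - α₁ ^ p * v₁ ^ p) := by
    rw [hu, mul_inv_cancel_left₀ hβ]
  have hv₂p : α₂ ^ p * v₂ ^ p = α₁ ^ p * v₁ ^ p := by
    rw [← mul_pow, ← mul_pow, hv₂]
    congr 1
    field_simp
  have hv₂q : v₂ ^ (p - 1) = (C + 1) * v₁ ^ (p - 1) := by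
    rw [hv₂, mul_pow, hC, sub_add_cancel]
  rw [← hβu] at hv₁
  have hquot : (α₂ ^ p - α₁ ^ p) * C⁻¹ = β * u * v₁ ^ (p - 1) := by
    rw [← hv₁]
    field_simp
  rw [hquot] at hA
  rw [hv₂p, hv₂q, hv₃, one_pow, one_pow]
  constructor
  · linear_combination hv₁
  · linear_combination hβu + hA
end
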